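/- arXiv:1502.07246 — 3 statements merged into one kernel-verified Lean document; each statement's English description precedes it below -/
import Mathlib

section
/- Let Y ⊆ ℝ and let f₁,…,f_M be continuous probability densities on Y with cdfs F₁,…,F_M. Let u₀ be a continuous probability density on (0,1) with ∫₀¹ [|log x| + |log(1−x)|] u₀(x) dx < +∞ and ∫₀¹ u₀(x) log u₀(x) dx < +∞. Let ω* be a point in the interior of Δ_M with inf_{y∈C} h(y|ω*) > 0 for every compact set C ⊆ Y, and set f₀(y) = u₀(H(y|ω*)) h(y|ω*). Let Θ = Δ_M × (0,1) × (0,∞), K(y;ω,μ,ν) = b*_{μ,ν}(H(y|ω)) h(y|ω), and let Π be a Borel probability measure on the space of Borel probability measures on Θ (weak topology) whose topological support contains every finitely supported probability measure on Θ. Then for every ε > 0, Π({G : KL(f₀, f_G) ≤ ε}) > 0, where f_G(y) = ∫_Θ K(y;θ) G(dθ). -/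
open MeasureTheory Set

/-- Reparametrized beta density `b*_{μ,ν}`. -/
noncomputable def betaStar (μ ν x : ℝ) : ℝ :=
  (Real.Gamma ν / (Real.Gamma (μ * ν) * Real.Gamma ((1 - μ) * ν))) *
    x ^ (μ * ν - 1) * (1 - x) ^ ((1 - μ) * ν - 1)

/-- Cdf of a density `f` on `ℝ`. -/
noncomputable def cdfOf (f : ℝ → ℝ) (y : ℝ) : ℝ := ∫ z in Iic y, f z

/-- Topological support of a measure. -/
def measureSupport {X : Type*} [TopologicalSpace X] [MeasurableSpace X]
    (μ : Measure X) : Set X :=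
  {x | ∀ U : Set X, IsOpen U → x ∈ U → 0 < μ U}

noncomputable instance {X : Type*} [MeasurableSpace X] [TopologicalSpace X]
    [OpensMeasurableSpace X] : MeasurableSpace (ProbabilityMeasure X) := borel _

/-- The parameter space `Θ = Δ_M × (0,1) × (0,∞)`. -/
def ThetaSet (M : ℕ) : Set ((Fin M → ℝ) × ℝ × ℝ) :=
  {θ | θ.1 ∈ stdSimplex ℝ (Fin M) ∧ θ.2.1 ∈ Ioo (0:ℝ) 1 ∧ 0 < θ.2.2}

/-- Beta-calibrated pooling kernel `K(y;ω,μ,ν) = b*_{μ,ν}(H(y|ω)) h(y|ω)`. -/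
noncomputable def poolKernel (M : ℕ) (f : Fin M → ℝ → ℝ) (y : ℝ) (θ : ThetaSet M) : ℝ :=
  betaStar θ.1.2.1 θ.1.2.2 (∑ m, θ.1.1 m * cdfOf (f m) y) * (∑ m, θ.1.1 m * f m y)

/-- Mixture density `f_G(y) = ∫ K(y;θ) G(dθ)`. -/
noncomputable def mixDensity (M : ℕ) (f : Fin M → ℝ → ℝ)
    (G : ProbabilityMeasure (ThetaSet M)) (y : ℝ) : ℝ :=
  ∫ θ, poolKernel M f y θ ∂(G : Measure (ThetaSet M))

open Filter Topology

lemma betaStar_eq_betaPDFReal {μ ν x : ℝ} (hx : x ∈ Ioo (0:ℝ) 1) :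
    betaStar μ ν x = ProbabilityTheory.betaPDFReal (μ * ν) ((1 - μ) * ν) x := by
  have h : μ * ν + (1 - μ) * ν = ν := by ring
  rw [betaStar, ProbabilityTheory.betaPDFReal, if_pos (mem_Ioo.1 hx), ProbabilityTheory.beta, h, one_div_div]

lemma betaStar_nonneg {μ ν x : ℝ} (hμ : μ ∈ Ioo (0:ℝ) 1) (hν : 0 < ν) (hx : x ∈ Icc (0:ℝ) 1) :
    0 ≤ betaStar μ ν x := by
  have h1 := Real.Gamma_pos_of_pos hν
  have h2 := Real.Gamma_pos_of_pos (mul_pos hμ.1 hν)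
  have h3 := Real.Gamma_pos_of_pos (mul_pos (sub_pos.2 hμ.2) hν)
  have h4 : 0 ≤ 1 - x := sub_nonneg.2 hx.2
  have h5 := hx.1
  unfold betaStar
  positivity

lemma measurable_betaStar (μ ν : ℝ) : Measurable (betaStar μ ν) := by
  unfold betaStar
  fun_prop

lemma lintegral_betaStar {μ ν : ℝ} (hμ : μ ∈ Ioo (0:ℝ) 1) (hν : 0 < ν) :
    ∫⁻ x in Ioo (0:ℝ) 1, ENNReal.ofReal (betaStar μ ν x) = 1 := by
  rw [← ProbabilityTheory.lintegral_betaPDF_eq_one (mul_pos hμ.1 hν)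
    (mul_pos (sub_pos.2 hμ.2) hν), ProbabilityTheory.lintegral_betaPDF]
  refine setLIntegral_congr_fun measurableSet_Ioo fun x hx => ?_
  rw [betaStar_eq_betaPDFReal hx, ProbabilityTheory.betaPDFReal, if_pos (mem_Ioo.1 hx)]

section ProbabilityIntegralTransform

variable {h : ℝ → ℝ}

lemma lintegral_ofReal_eq_one (h0 : ∀ y, 0 ≤ h y) (h1 : ∫ y, h y = 1) :
    ∫⁻ y, ENNReal.ofReal (h y) = 1 := by
  rw [← ofReal_integral_eq_lintegral_ofReal (integrable_of_integral_eq_one h1)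
    (Eventually.of_forall h0), h1, ENNReal.ofReal_one]

lemma monotone_cdfOf (h0 : ∀ y, 0 ≤ h y) (h1 : ∫ y, h y = 1) : Monotone (cdfOf h) :=
  fun _ _ hab => setIntegral_mono_set (integrable_of_integral_eq_one h1).integrableOn
    (Eventually.of_forall h0) (Iic_subset_Iic.2 hab).eventuallyLE

lemma cdfOf_mem_Icc (h0 : ∀ y, 0 ≤ h y) (h1 : ∫ y, h y = 1) (y : ℝ) :
    cdfOf h y ∈ Icc (0:ℝ) 1 :=
  ⟨integral_nonneg h0, h1 ▸ setIntegral_le_integral (integrable_of_integral_eq_one h1)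
    (Eventually.of_forall h0)⟩

lemma continuous_cdfOf (h1 : ∫ y, h y = 1) : Continuous (cdfOf h) := by
  have hi := integrable_of_integral_eq_one h1
  have : cdfOf h = fun y => (∫ z in Iic 0, h z) + ∫ z in (0:ℝ)..y, h z := by
    ext y
    rw [← intervalIntegral.integral_Iic_sub_Iic hi.integrableOn hi.integrableOn, cdfOf]
    ring
  rw [this]
  exact continuous_const.add (hi.continuous_primitive 0)

lemma withDensity_Iic (h0 : ∀ y, 0 ≤ h y) (h1 : ∫ y, h y = 1) (y : ℝ) :
    volume.withDensity (fun y => ENNReal.ofReal (h y)) (Iic y) = ENNReal.ofReal (cdfOf h y) := by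
  rw [withDensity_apply _ measurableSet_Iic, cdfOf, ofReal_integral_eq_lintegral_ofReal
    (integrable_of_integral_eq_one h1).integrableOn (Eventually.of_forall h0)]

lemma isProbabilityMeasure_withDensity (h0 : ∀ y, 0 ≤ h y) (h1 : ∫ y, h y = 1) :
    IsProbabilityMeasure (volume.withDensity (fun y => ENNReal.ofReal (h y))) :=
  ⟨by rw [withDensity_apply _ MeasurableSet.univ, Measure.restrict_univ,
    lintegral_ofReal_eq_one h0 h1]⟩

lemma cdfOf_eq_cdf (h0 : ∀ y, 0 ≤ h y) (h1 : ∫ y, h y = 1) :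
    cdfOf h = ProbabilityTheory.cdf (volume.withDensity (fun y => ENNReal.ofReal (h y))) := by
  have := isProbabilityMeasure_withDensity h0 h1
  ext y
  rw [ProbabilityTheory.cdf_eq_real, Measure.real, withDensity_Iic h0 h1,
    ENNReal.toReal_ofReal (cdfOf_mem_Icc h0 h1 y).1]

/-- The probability integral transform: a continuous cdf pushes its law to the uniform law. -/
lemma map_cdfOf (h0 : ∀ y, 0 ≤ h y) (h1 : ∫ y, h y = 1) :
    (volume.withDensity (fun y => ENNReal.ofReal (h y))).map (cdfOf h) =
      volume.restrict (Ioo (0:ℝ) 1) := by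
  have hP := isProbabilityMeasure_withDensity h0 h1
  have hc := continuous_cdfOf h1
  have hmap : IsProbabilityMeasure
      ((volume.withDensity (fun y => ENNReal.ofReal (h y))).map (cdfOf h)) :=
    Measure.isProbabilityMeasure_map hc.measurable.aemeasurable
  have hbot : Tendsto (cdfOf h) atBot (𝓝 0) := by
    rw [cdfOf_eq_cdf h0 h1]; exact ProbabilityTheory.tendsto_cdf_atBot _
  have htop : Tendsto (cdfOf h) atTop (𝓝 1) := by
    rw [cdfOf_eq_cdf h0 h1]; exact ProbabilityTheory.tendsto_cdf_atTop _
  refine Measure.ext_of_Iic _ _ fun t => ?_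
  rw [Measure.map_apply hc.measurable measurableSet_Iic,
    Measure.restrict_apply measurableSet_Iic]
  rcases le_or_gt 1 t with ht | ht
  · have e1 : cdfOf h ⁻¹' Iic t = univ :=
      eq_univ_of_forall fun y => (cdfOf_mem_Icc h0 h1 y).2.trans ht
    have e2 : Iic t ∩ Ioo (0:ℝ) 1 = Ioo 0 1 :=
      inter_eq_right.2 fun x hx => hx.2.le.trans ht
    rw [e1, e2, measure_univ]
    simp
  have e2 : volume (Iic t ∩ Ioo (0:ℝ) 1) = ENNReal.ofReal t := by
    have : Iic t ∩ Ioo (0:ℝ) 1 = Ioc 0 t := by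
      ext x
      simp only [mem_inter_iff, mem_Iic, mem_Ioo, mem_Ioc]
      constructor
      · rintro ⟨a, b, c⟩; exact ⟨b, a⟩
      · rintro ⟨a, b⟩; exact ⟨b, a, b.trans_lt ht⟩
    rw [this, Real.volume_Ioc, sub_zero]
  rw [e2]
  rcases (cdfOf h ⁻¹' Iic t).eq_empty_or_nonempty with he | hne
  · have : t ≤ 0 := by
      refine ge_of_tendsto hbot (Eventually.of_forall fun y => ?_)
      by_contra hy
      exact (he ▸ (mem_preimage.2 (not_le.1 hy).le) : y ∈ (∅ : Set ℝ))
    rw [he, measure_empty, ENNReal.ofReal_of_nonpos this]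
  · have hbdd : BddAbove (cdfOf h ⁻¹' Iic t) := by
      obtain ⟨b, hb⟩ := (htop.eventually (lt_mem_nhds ht)).exists
      refine ⟨b, fun y hy => ?_⟩
      by_contra hyb
      exact absurd (hb.trans_le (monotone_cdfOf h0 h1 (not_le.1 hyb).le)) (not_lt.2 hy)
    have hmem := (isClosed_Iic.preimage hc).csSup_mem hne hbdd
    set s := sSup (cdfOf h ⁻¹' Iic t) with hs
    have hIic : cdfOf h ⁻¹' Iic t = Iic s := by
      ext y
      exact ⟨fun hy => le_csSup hbdd hy, fun hy => (monotone_cdfOf h0 h1 hy).trans hmem⟩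
    have hval : cdfOf h s = t := by
      refine le_antisymm hmem ?_
      refine ge_of_tendsto (hc.continuousAt.tendsto.mono_left nhdsWithin_le_nhds :
        Tendsto (cdfOf h) (𝓝[>] s) (𝓝 (cdfOf h s))) ?_
      filter_upwards [self_mem_nhdsWithin] with y hy
      by_contra hyt
      exact absurd (hIic ▸ (mem_preimage.2 (not_le.1 hyt).le) : y ∈ Iic s) (not_le.2 (mem_Ioi.1 hy) : ¬ y ≤ s)
    rw [hIic, withDensity_Iic h0 h1, hval]

lemma lintegral_comp_cdfOf_mul (h0 : ∀ y, 0 ≤ h y) (hm : Measurable h) (h1 : ∫ y, h y = 1)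
    {φ : ℝ → ENNReal} (hφ : Measurable φ) :
    ∫⁻ y, φ (cdfOf h y) * ENNReal.ofReal (h y) = ∫⁻ x in Ioo (0:ℝ) 1, φ x := by
  have hc := (continuous_cdfOf h1).measurable
  rw [← map_cdfOf h0 h1, lintegral_map hφ hc,
    lintegral_withDensity_eq_lintegral_mul _ hm.ennreal_ofReal
      (show Measurable fun y => φ (cdfOf h y) from hφ.comp hc)]
  simp [mul_comm]

lemma integrable_comp_cdfOf_mul (h0 : ∀ y, 0 ≤ h y) (hm : Measurable h) (h1 : ∫ y, h y = 1)
    {φ : ℝ → ℝ} (hφ : IntegrableOn φ (Ioo (0:ℝ) 1)) :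
    Integrable (fun y => φ (cdfOf h y) * h y) := by
  have hc := (continuous_cdfOf h1).measurable
  rw [IntegrableOn, ← map_cdfOf h0 h1] at hφ
  have := (integrable_map_measure hφ.1 hc.aemeasurable).1 hφ
  rw [integrable_withDensity_iff_integrable_smul' hm.ennreal_ofReal
    (Eventually.of_forall fun _ => ENNReal.ofReal_lt_top)] at this
  refine this.congr (Eventually.of_forall fun y => ?_)
  simp [ENNReal.toReal_ofReal (h0 y), mul_comm]

lemma integral_comp_cdfOf_mul (h0 : ∀ y, 0 ≤ h y) (hm : Measurable h) (h1 : ∫ y, h y = 1)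
    {φ : ℝ → ℝ} (hφ : IntegrableOn φ (Ioo (0:ℝ) 1)) :
    ∫ y, φ (cdfOf h y) * h y = ∫ x in Ioo (0:ℝ) 1, φ x := by
  have hc := (continuous_cdfOf h1).measurable
  rw [IntegrableOn, ← map_cdfOf h0 h1] at hφ
  rw [← map_cdfOf h0 h1, integral_map hc.aemeasurable hφ.1,
    integral_withDensity_eq_integral_toReal_smul hm.ennreal_ofReal
    (Eventually.of_forall fun _ => ENNReal.ofReal_lt_top)]
  refine integral_congr_ae (Eventually.of_forall fun y => ?_)
  simp [ENNReal.toReal_ofReal (h0 y), mul_comm]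

end ProbabilityIntegralTransform

section BetaMixtureApproximation

variable {u : ℝ → ℝ}

lemma continuous_min_bump (h0 : ∀ x, 0 ≤ u x) (hc : ContinuousOn u (Ioo (0:ℝ) 1))
    (hs : ∀ x ∉ Ioo (0:ℝ) 1, u x = 0) {k : ℝ} (hk : 0 ≤ k) :
    Continuous fun x => min (u x) (k * max 0 (x * (1 - x))) := by
  have hb : Continuous fun x : ℝ => k * max 0 (x * (1 - x)) := by fun_prop
  refine continuous_iff_continuousAt.2 fun x => ?_
  by_cases hx : x ∈ Ioo (0:ℝ) 1
  · exact (hc.continuousAt (isOpen_Ioo.mem_nhds hx)).min hb.continuousAt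
  · have hbx : k * max 0 (x * (1 - x)) = 0 := by
      rw [max_eq_left, mul_zero]
      simp only [mem_Ioo, not_and_or, not_lt] at hx
      rcases hx with h | h <;> nlinarith
    have hval : min (u x) (k * max 0 (x * (1 - x))) = 0 := by rw [hs x hx, hbx, min_self]
    have ht := hb.continuousAt (x := x)
    rw [ContinuousAt, hbx] at ht
    rw [ContinuousAt, hval]
    exact squeeze_zero (fun y => le_min (h0 y) (by positivity)) (fun y => min_le_right _ _) ht

/-- Bound for the logarithm of a perturbation of `a` from below. -/
lemma abs_mul_log_div_le {a v η : ℝ} (hv : 0 ≤ v) (hva : v ≤ a) (hη : 0 < η) (hη1 : η ≤ 1) :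
    |a * Real.log (a / (v + η))| ≤ 2 * |a * Real.log a| + (Real.log 2 + |Real.log η|) * a := by
  rcases (hv.trans hva).eq_or_lt with h | ha
  · simp [← h]
  have hvη : 0 < v + η := by linarith
  have h1 : Real.log η ≤ Real.log (v + η) := Real.log_le_log hη (by linarith)
  have h2 : Real.log (v + η) ≤ Real.log 2 + |Real.log a| := by
    rcases le_total a 1 with h | h
    · have : Real.log (v + η) ≤ Real.log 2 := Real.log_le_log hvη (by linarith)
      linarith [abs_nonneg (Real.log a)]
    · have : Real.log (v + η) ≤ Real.log (2 * a) := Real.log_le_log hvη (by linarith)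
      rw [Real.log_mul two_ne_zero ha.ne'] at this
      linarith [le_abs_self (Real.log a)]
  have h3 : |Real.log (v + η)| ≤ Real.log 2 + |Real.log a| + |Real.log η| := by
    rw [abs_le]
    constructor
    · linarith [neg_abs_le (Real.log η), abs_nonneg (Real.log a), Real.log_pos one_lt_two]
    · linarith [abs_nonneg (Real.log η)]
  rw [Real.log_div ha.ne' hvη.ne', abs_mul, abs_mul, abs_of_pos ha]
  have h4 := abs_sub (Real.log a) (Real.log (v + η))
  nlinarith

lemma exists_continuous_le_integral_log_div (h0 : ∀ x, 0 ≤ u x) (hm : Measurable u)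
    (hc : ContinuousOn u (Ioo (0:ℝ) 1)) (hs : ∀ x ∉ Ioo (0:ℝ) 1, u x = 0)
    (hi : IntegrableOn u (Ioo (0:ℝ) 1))
    (hent : IntegrableOn (fun x => u x * Real.log (u x)) (Ioo (0:ℝ) 1))
    {η : ℝ} (hη : 0 < η) (hη1 : η ≤ 1) :
    ∃ v : ℝ → ℝ, Continuous v ∧ (∀ x, 0 ≤ v x) ∧ (∀ x, v x ≤ u x) ∧
      IntegrableOn (fun x => u x * Real.log (u x / (v x + η))) (Ioo (0:ℝ) 1) ∧
      ∫ x in Ioo (0:ℝ) 1, u x * Real.log (u x / (v x + η)) ≤ η := by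
  let v : ℕ → ℝ → ℝ := fun k x => min (u x) (k * max 0 (x * (1 - x)))
  have hvc : ∀ k, Continuous (v k) := fun k => continuous_min_bump h0 hc hs k.cast_nonneg
  have hv0 : ∀ k x, 0 ≤ v k x := fun k x => le_min (h0 x) (by positivity)
  have hvu : ∀ k x, v k x ≤ u x := fun k x => min_le_left _ _
  have hFm : ∀ k, Measurable fun x => u x * Real.log (u x / (v k x + η)) := fun k => by
    have := (hvc k).measurable
    fun_prop
  have hbound : IntegrableOn (fun x => 2 * |u x * Real.log (u x)| +
      (Real.log 2 + |Real.log η|) * u x) (Ioo (0:ℝ) 1) :=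
    (hent.abs.const_mul 2).add (hi.const_mul _)
  have hle : ∀ k x, ‖u x * Real.log (u x / (v k x + η))‖ ≤
      2 * |u x * Real.log (u x)| + (Real.log 2 + |Real.log η|) * u x :=
    fun k x => abs_mul_log_div_le (hv0 k x) (hvu k x) hη hη1
  have hlim : Tendsto (fun k => ∫ x in Ioo (0:ℝ) 1, u x * Real.log (u x / (v k x + η))) atTop
      (𝓝 (∫ x in Ioo (0:ℝ) 1, u x * Real.log (u x / (u x + η)))) := by
    refine tendsto_integral_of_dominated_convergence _ (fun k => (hFm k).aestronglyMeasurable)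
      hbound (fun k => Eventually.of_forall (hle k)) ?_
    filter_upwards [ae_restrict_mem measurableSet_Ioo] with x hx
    have hx' : 0 < x * (1 - x) := mul_pos hx.1 (sub_pos.2 hx.2)
    refine tendsto_const_nhds.congr' ?_
    filter_upwards [eventually_ge_atTop ⌈u x / (x * (1 - x))⌉₊] with k hk
    have : u x ≤ k * max 0 (x * (1 - x)) := by
      rw [max_eq_right hx'.le, ← div_le_iff₀ hx']
      exact Nat.ceil_le.1 hk
    simp only [v, min_eq_left this]
  have hneg : ∫ x in Ioo (0:ℝ) 1, u x * Real.log (u x / (u x + η)) ≤ 0 := by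
    refine integral_nonpos fun x => mul_nonpos_of_nonneg_of_nonpos (h0 x)
      (Real.log_nonpos (div_nonneg (h0 x) (by linarith [h0 x])) ?_)
    exact div_le_one_of_le₀ (by linarith) (by linarith [h0 x])
  obtain ⟨k, hk⟩ := (hlim.eventually (gt_mem_nhds (hneg.trans_lt hη))).exists
  exact ⟨v k, hvc k, hv0 k, hvu k,
    hbound.mono' (hFm k).aestronglyMeasurable (Eventually.of_forall (hle k)), hk.le⟩

lemma betaStar_eq_choose {n k : ℕ} (hk : k ≤ n) (x : ℝ) :
    betaStar ((k + 1) / (n + 2)) (n + 2) x =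
      (n + 1) * (n.choose k * x ^ k * (1 - x) ^ (n - k)) := by
  have hn : (n:ℝ) + 2 ≠ 0 := by positivity
  have e1 : ((k:ℝ) + 1) / (n + 2) * (n + 2) = k + 1 := div_mul_cancel₀ _ hn
  have e2 : (1 - ((k:ℝ) + 1) / (n + 2)) * (n + 2) = (n - k : ℕ) + 1 := by
    rw [Nat.cast_sub hk]; field_simp; ring
  have e3 : (n:ℝ) + 2 = (n + 1 : ℕ) + 1 := by push_cast; ring
  rw [betaStar, e1, e2, e3, Real.Gamma_nat_eq_factorial, Real.Gamma_nat_eq_factorial,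
    Real.Gamma_nat_eq_factorial, add_sub_cancel_right, add_sub_cancel_right, Real.rpow_natCast,
    Real.rpow_natCast, Nat.choose_eq_factorial_div_factorial hk,
    Nat.cast_div (Nat.factorial_mul_factorial_dvd_factorial hk) (by positivity),
    Nat.factorial_succ]
  push_cast
  ring

lemma integrableOn_betaStar {μ ν : ℝ} (hμ : μ ∈ Ioo (0:ℝ) 1) (hν : 0 < ν) :
    IntegrableOn (betaStar μ ν) (Ioo (0:ℝ) 1) := by
  refine ⟨(measurable_betaStar μ ν).aestronglyMeasurable, ?_⟩
  rw [hasFiniteIntegral_iff_ofReal, lintegral_betaStar hμ hν]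
  · exact ENNReal.one_lt_top
  · filter_upwards [ae_restrict_mem measurableSet_Ioo] with x hx
    exact betaStar_nonneg hμ hν (Ioo_subset_Icc_self hx)

lemma integral_betaStar {μ ν : ℝ} (hμ : μ ∈ Ioo (0:ℝ) 1) (hν : 0 < ν) :
    ∫ x in Ioo (0:ℝ) 1, betaStar μ ν x = 1 := by
  rw [integral_eq_lintegral_of_nonneg_ae _ (measurable_betaStar μ ν).aestronglyMeasurable,
    lintegral_betaStar hμ hν, ENNReal.toReal_one]
  filter_upwards [ae_restrict_mem measurableSet_Ioo] with x hx
  exact betaStar_nonneg hμ hν (Ioo_subset_Icc_self hx)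

lemma div_mem_Ioo_of_le {n k : ℕ} (hk : k ≤ n) : ((k:ℝ) + 1) / (n + 2) ∈ Ioo (0:ℝ) 1 := by
  have : (k:ℝ) ≤ n := by exact_mod_cast hk
  exact ⟨by positivity, (div_lt_one (by positivity)).2 (by linarith)⟩

/-- A continuous density with finite entropy is approximated in Kullback–Leibler divergence by
finite beta mixtures, whose density is moreover bounded below by a function `l` which itself
achieves the approximation. -/
lemma exists_beta_mixture (h0 : ∀ x, 0 ≤ u x) (hm : Measurable u)
    (hc : ContinuousOn u (Ioo (0:ℝ) 1)) (hs : ∀ x ∉ Ioo (0:ℝ) 1, u x = 0)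
    (h1 : ∫ x in Ioo (0:ℝ) 1, u x = 1)
    (hent : IntegrableOn (fun x => u x * Real.log (u x)) (Ioo (0:ℝ) 1))
    {ε : ℝ} (hε : 0 < ε) :
    ∃ (n : ℕ) (c μ ν : Fin (n + 1) → ℝ) (l : ℝ → ℝ), (∀ k, 0 ≤ c k) ∧ ∑ k, c k = 1 ∧
      (∀ k, μ k ∈ Ioo (0:ℝ) 1) ∧ (∀ k, 0 < ν k) ∧
      (∀ x ∈ Ioo (0:ℝ) 1, 0 < l x ∧ l x ≤ ∑ k, c k * betaStar (μ k) (ν k) x) ∧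
      IntegrableOn (fun x => u x * Real.log (u x / l x)) (Ioo (0:ℝ) 1) ∧
      ∫ x in Ioo (0:ℝ) 1, u x * Real.log (u x / l x) ≤ ε := by
  have hi : IntegrableOn u (Ioo (0:ℝ) 1) := integrable_of_integral_eq_one h1
  set η := min 1 (ε / 4) with hηdef
  have hη : 0 < η := lt_min one_pos (by positivity)
  have hηε : η ≤ ε / 4 := min_le_right _ _
  obtain ⟨v, hvc, hv0, hvu, hvi, hvint⟩ :=
    exists_continuous_le_integral_log_div h0 hm hc hs hi hent hη (min_le_left _ _)
  let w : C(unitInterval, ℝ) := ⟨fun x => v x + 2 * η, by fun_prop⟩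
  have hw : ∀ x : unitInterval, w x = v x + 2 * η := fun _ => rfl
  have hw0 : ∀ x : unitInterval, 0 < w x := fun x => by rw [hw]; linarith [hv0 x]
  obtain ⟨n, hn⟩ : ∃ n, dist (bernsteinApproximation n w) w < η :=
    ((Metric.tendsto_nhds.1 (bernsteinApproximation_uniform w)) η hη).exists
  let z : Fin (n + 1) → unitInterval := bernstein.z
  let μ : Fin (n + 1) → ℝ := fun k => ((k:ℕ) + 1) / (n + 2)
  let ν : Fin (n + 1) → ℝ := fun _ => n + 2
  have hμ : ∀ k, μ k ∈ Ioo (0:ℝ) 1 := fun k => div_mem_Ioo_of_le k.is_le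
  have hν : ∀ k, 0 < ν k := fun k => by positivity
  let b : Fin (n + 1) → ℝ := fun k => w (z k) / (n + 1)
  have hb : ∀ k, 0 < b k := fun k => div_pos (hw0 _) (by positivity)
  let p : ℝ → ℝ := fun x => ∑ k, b k * betaStar (μ k) (ν k) x
  have hp : ∀ x ∈ Ioo (0:ℝ) 1, v x + η ≤ p x ∧ p x ≤ v x + 3 * η := fun x hx => by
    have hx' : x ∈ unitInterval := Ioo_subset_Icc_self hx
    have e : bernsteinApproximation n w ⟨x, hx'⟩ = p x := by
      rw [bernsteinApproximation.apply]
      refine Finset.sum_congr rfl fun k _ => ?_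
      have hn1 : (n:ℝ) + 1 ≠ 0 := by positivity
      simp only [bernstein_apply, smul_eq_mul, b, μ, ν, z, betaStar_eq_choose k.is_le]
      field_simp
    have hd := (ContinuousMap.dist_apply_le_dist (⟨x, hx'⟩ : unitInterval)).trans_lt hn
    rw [e, hw, Real.dist_eq, abs_lt] at hd
    constructor <;> linarith [hd.1, hd.2]
  set T := ∑ k, b k with hT
  have hTpos : 0 < T := Finset.sum_pos (fun k _ => hb k) Finset.univ_nonempty
  have hpi : ∀ k ∈ Finset.univ,
      IntegrableOn (fun x => b k * betaStar (μ k) (ν k) x) (Ioo (0:ℝ) 1) :=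
    fun k _ => (integrableOn_betaStar (hμ k) (hν k)).const_mul _
  have hTp : ∫ x in Ioo (0:ℝ) 1, p x = T := by
    rw [integral_finsetSum _ hpi]
    refine Finset.sum_congr rfl fun k _ => ?_
    rw [integral_const_mul, integral_betaStar (hμ k) (hν k), mul_one]
  have hconst : IntegrableOn (fun _ : ℝ => 3 * η) (Ioo (0:ℝ) 1) := integrableOn_const (by simp)
  have hTle : T ≤ 1 + 3 * η := by
    calc T = ∫ x in Ioo (0:ℝ) 1, p x := hTp.symm
      _ ≤ ∫ x in Ioo (0:ℝ) 1, (u x + 3 * η) :=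
        setIntegral_mono_on (integrable_finsetSum _ hpi) (hi.add hconst) measurableSet_Ioo
          fun x hx => by linarith [(hp x hx).2, hvu x]
      _ = 1 + 3 * η := by
        rw [integral_add hi hconst, h1]
        simp
  have hlogT : Real.log T ≤ 3 * η := by linarith [Real.log_le_sub_one_of_pos hTpos]
  have hlog : ∀ x, u x * Real.log (u x / ((v x + η) / T)) =
      u x * Real.log (u x / (v x + η)) + u x * Real.log T := fun x => by
    rcases (h0 x).eq_or_lt with h | h
    · simp [← h]
    · have : 0 < v x + η := by linarith [hv0 x]
      rw [div_div_eq_mul_div, Real.log_div (by positivity) this.ne',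
        Real.log_mul h.ne' hTpos.ne', Real.log_div h.ne' this.ne']
      ring
  refine ⟨n, fun k => b k / T, μ, ν, fun x => (v x + η) / T, fun k => (div_pos (hb k) hTpos).le,
    ?_, hμ, hν, fun x hx => ⟨div_pos (by linarith [hv0 x]) hTpos, ?_⟩, ?_, ?_⟩
  · rw [← Finset.sum_div, div_self hTpos.ne']
  · calc (v x + η) / T ≤ p x / T := by gcongr; exact (hp x hx).1
      _ = _ := by
        rw [Finset.sum_div]
        exact Finset.sum_congr rfl fun k _ => by ring
  · simp_rw [hlog]
    exact hvi.add (hi.mul_const _)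
  · simp_rw [hlog]
    rw [integral_add hvi (hi.mul_const _), integral_mul_const, h1]
    linarith

end BetaMixtureApproximation

lemma integral_eq_sum_of_measure_finset_eq_one {X : Type*} [MeasurableSpace X]
    [MeasurableSingletonClass X] {P : Measure X} [IsProbabilityMeasure P] {S : Finset X}
    (hS : P ↑S = 1) (m : X → ℝ) : ∫ x, m x ∂P = ∑ x ∈ S, P.real {x} * m x := by
  have hae : ∀ᵐ x ∂P, x ∈ (S : Set X) := (mem_ae_iff_prob_eq_one S.measurableSet).2 hS
  have hi : ∀ x ∈ S, IntegrableOn m {x} P := fun x _ =>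
    integrableOn_singleton
  have hae' : P.restrict (⋃ x ∈ S, {x}) = P := by
    refine Measure.restrict_eq_self_of_ae_mem (hae.mono fun x hx => ?_)
    simpa using hx
  calc ∫ x, m x ∂P = ∫ x in ⋃ x ∈ S, {x}, m x ∂P := by rw [hae']
    _ = ∑ x ∈ S, ∫ y in {x}, m y ∂P := integral_biUnion_finset S
        (fun x _ => measurableSet_singleton x)
        (fun x _ y _ hxy => disjoint_singleton.2 hxy) hi
    _ = ∑ x ∈ S, P.real {x} * m x := by simp [Measure.real]

/-- Weak lower semicontinuity at a finitely supported measure, for integrands controlled near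
the support. -/
lemma eventually_exp_mul_integral_le {X : Type*} [TopologicalSpace X] [T2Space X]
    [MeasurableSpace X] [OpensMeasurableSpace X] [HasOuterApproxClosed X]
    (G₀ : ProbabilityMeasure X) {S : Finset X} (hS : (G₀ : Measure X) ↑S = 1) {N : X → Set X}
    (hN : ∀ x ∈ S, N x ∈ 𝓝 x) {δ : ℝ} (hδ : 0 < δ) :
    ∀ᶠ G : ProbabilityMeasure X in 𝓝 G₀, ∀ φ m : X → ℝ, (∀ x, 0 ≤ φ x) → (∀ x, 0 ≤ m x) →
      Integrable φ (G : Measure X) → (∀ x ∈ S, ∀ y ∈ N x, m x ≤ φ y) →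
      Real.exp (-δ) * ∫ x, m x ∂(G₀ : Measure X) ≤ ∫ x, φ x ∂(G : Measure X) := by
  obtain ⟨U, hU, hdisj⟩ := S.finite_toSet.t2_separation
  let V : X → Set X := fun x => U x ∩ interior (N x)
  have hVo : ∀ x, IsOpen (V x) := fun x => (hU x).2.inter isOpen_interior
  have hVx : ∀ x ∈ S, x ∈ V x := fun x hx => ⟨(hU x).1, mem_interior_iff_mem_nhds.2 (hN x hx)⟩
  have hVd : (S : Set X).PairwiseDisjoint V :=
    hdisj.mono fun x => inter_subset_left
  have hev : ∀ x ∈ S, ∀ᶠ G : ProbabilityMeasure X in 𝓝 G₀,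
      Real.exp (-δ) * (G₀ : Measure X).real {x} ≤ (G : Measure X).real (V x) := by
    intro x hx
    rcases (measureReal_nonneg (μ := (G₀ : Measure X)) (s := {x})).eq_or_lt with h0 | hpos
    · exact Eventually.of_forall fun G => by rw [← h0, mul_zero]; exact measureReal_nonneg
    have hlt : Real.exp (-δ) * (G₀ : Measure X).real {x} < (G₀ : Measure X).real (V x) :=
      (mul_lt_of_lt_one_left hpos (Real.exp_lt_one_iff.2 (by linarith))).trans_le
        (measureReal_mono (singleton_subset_iff.2 (hVx x hx)))
    have hlt' : ENNReal.ofReal (Real.exp (-δ) * (G₀ : Measure X).real {x}) <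
        (G₀ : Measure X) (V x) := by
      rwa [ENNReal.ofReal_lt_iff_lt_toReal (by positivity) (measure_ne_top _ _)]
    filter_upwards [eventually_lt_of_lt_liminf (hlt'.trans_le
      (ProbabilityMeasure.le_liminf_measure_open_of_tendsto tendsto_id (hVo x)))] with G hG
    exact (ENNReal.ofReal_le_iff_le_toReal (measure_ne_top _ _)).1 hG.le
  filter_upwards [(Finset.eventually_all S).2 hev] with G hG φ m hφ hm hint hle
  calc Real.exp (-δ) * ∫ x, m x ∂(G₀ : Measure X)
      = ∑ x ∈ S, (Real.exp (-δ) * (G₀ : Measure X).real {x}) * m x := by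
        rw [integral_eq_sum_of_measure_finset_eq_one hS, Finset.mul_sum]
        simp_rw [mul_assoc]
    _ ≤ ∑ x ∈ S, (G : Measure X).real (V x) * m x :=
        Finset.sum_le_sum fun x hx => mul_le_mul_of_nonneg_right (hG x hx) (hm x)
    _ ≤ ∑ x ∈ S, ∫ y in V x, φ y ∂(G : Measure X) := by
        refine Finset.sum_le_sum fun x hx => ?_
        exact setIntegral_ge_of_const_le (hVo x).measurableSet (measure_ne_top _ _)
          (fun y hy => hle x hx y (interior_subset hy.2)) hint.integrableOn
    _ = ∫ y in ⋃ x ∈ S, V x, φ y ∂(G : Measure X) :=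
        (integral_biUnion_finset S (fun x _ => (hVo x).measurableSet) hVd
          fun x _ => hint.integrableOn).symm
    _ ≤ ∫ y, φ y ∂(G : Measure X) :=
        setIntegral_le_integral hint (Eventually.of_forall hφ)

section KernelPerturbation

/-- Logarithm of the normalizing constant of the reparametrized beta density. -/
noncomputable def logBetaConst (μ ν : ℝ) : ℝ :=
  Real.log (Real.Gamma ν / (Real.Gamma (μ * ν) * Real.Gamma ((1 - μ) * ν)))

lemma betaStar_eq_exp {μ ν x : ℝ} (hμ : μ ∈ Ioo (0:ℝ) 1) (hν : 0 < ν) (hx : x ∈ Ioo (0:ℝ) 1) :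
    betaStar μ ν x = Real.exp (logBetaConst μ ν + (μ * ν - 1) * Real.log x +
      ((1 - μ) * ν - 1) * Real.log (1 - x)) := by
  have h1 := Real.Gamma_pos_of_pos hν
  have h2 := Real.Gamma_pos_of_pos (mul_pos hμ.1 hν)
  have h3 := Real.Gamma_pos_of_pos (mul_pos (sub_pos.2 hμ.2) hν)
  rw [betaStar, logBetaConst, Real.exp_add, Real.exp_add, Real.exp_log (by positivity),
    Real.rpow_def_of_pos hx.1, Real.rpow_def_of_pos (sub_pos.2 hx.2), mul_comm (Real.log x),
    mul_comm (Real.log (1 - x))]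

lemma continuousAt_Gamma_of_pos {x : ℝ} (hx : 0 < x) : ContinuousAt Real.Gamma x :=
  (Real.differentiableAt_Gamma fun m => by have := m.cast_nonneg (α := ℝ); linarith).continuousAt

lemma continuous_betaConst (M : ℕ) : Continuous fun θ : ThetaSet M =>
    Real.Gamma θ.1.2.2 /
      (Real.Gamma (θ.1.2.1 * θ.1.2.2) * Real.Gamma ((1 - θ.1.2.1) * θ.1.2.2)) := by
  refine continuous_iff_continuousAt.2 fun θ => ?_
  have hμ := θ.2.2.1
  have hν := θ.2.2.2
  have h1 := mul_pos hμ.1 hν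
  have h2 := mul_pos (sub_pos.2 hμ.2) hν
  have c0 : ContinuousAt (fun θ : ThetaSet M => θ.1.2.2) θ := by fun_prop
  have c1 : ContinuousAt (fun θ : ThetaSet M => θ.1.2.1 * θ.1.2.2) θ := by fun_prop
  have c2 : ContinuousAt (fun θ : ThetaSet M => (1 - θ.1.2.1) * θ.1.2.2) θ := by fun_prop
  exact (ContinuousAt.comp' (f := fun θ : ThetaSet M => θ.1.2.2)
    (continuousAt_Gamma_of_pos hν) c0).div
    ((ContinuousAt.comp' (f := fun θ : ThetaSet M => θ.1.2.1 * θ.1.2.2)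
    (continuousAt_Gamma_of_pos h1) c1).mul
      (ContinuousAt.comp' (f := fun θ : ThetaSet M => (1 - θ.1.2.1) * θ.1.2.2)
    (continuousAt_Gamma_of_pos h2) c2))
    (mul_pos (Real.Gamma_pos_of_pos h1) (Real.Gamma_pos_of_pos h2)).ne'

lemma continuous_logBetaConst (M : ℕ) : Continuous fun θ : ThetaSet M =>
    logBetaConst θ.1.2.1 θ.1.2.2 := by
  refine (continuous_betaConst M).log fun θ => ?_
  have hμ := θ.2.2.1
  have hν := θ.2.2.2
  exact (div_pos (Real.Gamma_pos_of_pos hν) (mul_pos (Real.Gamma_pos_of_pos (mul_pos hμ.1 hν))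
    (Real.Gamma_pos_of_pos (mul_pos (sub_pos.2 hμ.2) hν)))).ne'

lemma one_sub_sum_mul {M : ℕ} {ω : Fin M → ℝ} (hω : ω ∈ stdSimplex ℝ (Fin M)) (F : Fin M → ℝ) :
    1 - ∑ m, ω m * F m = ∑ m, ω m * (1 - F m) := by
  simp_rw [mul_sub, mul_one, Finset.sum_sub_distrib, hω.2]

lemma abs_log_sub_log_le {a b τ : ℝ} (hb : 0 < b) (h1 : Real.exp (-τ) * b ≤ a)
    (h2 : a ≤ Real.exp τ * b) : |Real.log a - Real.log b| ≤ τ := by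
  have ha : 0 < a := (mul_pos (Real.exp_pos _) hb).trans_le h1
  have e1 := Real.log_le_log (mul_pos (Real.exp_pos _) hb) h1
  have e2 := Real.log_le_log ha h2
  rw [Real.log_mul (Real.exp_ne_zero _) hb.ne', Real.log_exp] at e1 e2
  rw [abs_le]
  constructor <;> linarith

lemma mul_sub_mul_le {a a' l l' τ : ℝ} (ha : |a - a'| ≤ τ) (hl : |l - l'| ≤ τ) (hτ : τ ≤ 1) :
    a' * l' - τ * (1 + |a'| + |l'|) ≤ a * l := by
  have h1 : |(a - a') * (l - l')| ≤ τ * 1 := by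
    rw [abs_mul]
    exact mul_le_mul ha (hl.trans hτ) (abs_nonneg _) ((abs_nonneg _).trans ha)
  have h2 : |(a - a') * l'| ≤ τ * |l'| := by
    rw [abs_mul]; exact mul_le_mul_of_nonneg_right ha (abs_nonneg _)
  have h3 : |a' * (l - l')| ≤ |a'| * τ := by
    rw [abs_mul]; exact mul_le_mul_of_nonneg_left hl (abs_nonneg _)
  have := neg_abs_le ((a - a') * (l - l'))
  have := neg_abs_le ((a - a') * l')
  have := neg_abs_le (a' * (l - l'))
  nlinarith

/-- The calibrated pooling kernel is log-continuous in its parameter, with a modulus that grows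
only like the logarithms of the pooled cdf and of its complement. -/
lemma eventually_exp_mul_kernel_le {M : ℕ} (θ₀ : ThetaSet M) (hω₀ : ∀ m, 0 < θ₀.1.1 m) {δ : ℝ}
    (hδ : 0 < δ) :
    ∀ᶠ θ in 𝓝 θ₀, ∀ F g : Fin M → ℝ, (∀ m, F m ∈ Icc (0:ℝ) 1) → (∀ m, 0 ≤ g m) →
      ∑ m, θ₀.1.1 m * F m ∈ Ioo (0:ℝ) 1 →
      Real.exp (-(δ * (1 + |Real.log (∑ m, θ₀.1.1 m * F m)| +
          |Real.log (1 - ∑ m, θ₀.1.1 m * F m)|))) *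
        (betaStar θ₀.1.2.1 θ₀.1.2.2 (∑ m, θ₀.1.1 m * F m) * ∑ m, θ₀.1.1 m * g m) ≤
      betaStar θ.1.2.1 θ.1.2.2 (∑ m, θ.1.1 m * F m) * ∑ m, θ.1.1 m * g m := by
  set a₀ := θ₀.1.2.1 * θ₀.1.2.2 - 1 with ha₀
  set b₀ := (1 - θ₀.1.2.1) * θ₀.1.2.2 - 1 with hb₀
  have hB : 0 < 4 + |a₀| + |b₀| := by positivity
  set τ := min (min 1 δ) (δ / (4 + |a₀| + |b₀|)) with hτdef
  have hτ : 0 < τ := lt_min (lt_min one_pos hδ) (by positivity)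
  have hτ1 : τ ≤ 1 := (min_le_left _ _).trans (min_le_left _ _)
  have hτδ : τ ≤ δ := (min_le_left _ _).trans (min_le_right _ _)
  have hτB : τ * (4 + |a₀| + |b₀|) ≤ δ := by
    rw [← le_div_iff₀ hB]; exact min_le_right _ _
  have hnear : ∀ {φ : ThetaSet M → ℝ}, Continuous φ → ∀ᶠ θ in 𝓝 θ₀, |φ θ - φ θ₀| ≤ τ := by
    intro φ hφ
    filter_upwards [Metric.tendsto_nhds.1 hφ.continuousAt.tendsto τ hτ] with θ hθ
    exact hθ.le
  have hωev : ∀ᶠ θ : ThetaSet M in 𝓝 θ₀, ∀ m,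
      Real.exp (-τ) * θ₀.1.1 m ≤ θ.1.1 m ∧ θ.1.1 m ≤ Real.exp τ * θ₀.1.1 m := by
    refine eventually_all.2 fun m => ?_
    have hc : Tendsto (fun θ : ThetaSet M => θ.1.1 m) (𝓝 θ₀) (𝓝 (θ₀.1.1 m)) :=
      Continuous.tendsto (by fun_prop) θ₀
    filter_upwards [hc.eventually (lt_mem_nhds
      (mul_lt_of_lt_one_left (hω₀ m) (Real.exp_lt_one_iff.2 (by linarith : -τ < 0)))),
      hc.eventually (gt_mem_nhds (lt_mul_of_one_lt_left (hω₀ m) (Real.one_lt_exp_iff.2 hτ)))]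
      with θ h1 h2
    exact ⟨h1.le, h2.le⟩
  filter_upwards [hωev, hnear (continuous_logBetaConst M),
    hnear (φ := fun θ => θ.1.2.1 * θ.1.2.2 - 1) (by fun_prop),
    hnear (φ := fun θ => (1 - θ.1.2.1) * θ.1.2.2 - 1) (by fun_prop)]
    with θ hω hC ha hb F g hF hg hH₀
  have hsum : ∀ v : Fin M → ℝ, (∀ m, 0 ≤ v m) →
      Real.exp (-τ) * ∑ m, θ₀.1.1 m * v m ≤ ∑ m, θ.1.1 m * v m ∧
      ∑ m, θ.1.1 m * v m ≤ Real.exp τ * ∑ m, θ₀.1.1 m * v m := by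
    intro v hv
    simp_rw [Finset.mul_sum, ← mul_assoc]
    exact ⟨Finset.sum_le_sum fun m _ => mul_le_mul_of_nonneg_right (hω m).1 (hv m),
      Finset.sum_le_sum fun m _ => mul_le_mul_of_nonneg_right (hω m).2 (hv m)⟩
  have hs1 := hsum F fun m => (hF m).1
  have hs2 := hsum (fun m => 1 - F m) fun m => sub_nonneg.2 (hF m).2
  have hs3 := (hsum g hg).1
  rw [← one_sub_sum_mul θ₀.2.1, ← one_sub_sum_mul θ.2.1] at hs2
  set H₀ := ∑ m, θ₀.1.1 m * F m with hH₀def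
  set H := ∑ m, θ.1.1 m * F m with hHdef
  have hH₀' : 0 < 1 - H₀ := sub_pos.2 hH₀.2
  have hH : H ∈ Ioo (0:ℝ) 1 := ⟨(mul_pos (Real.exp_pos _) hH₀.1).trans_le hs1.1,
    sub_pos.1 ((mul_pos (Real.exp_pos _) hH₀').trans_le hs2.1)⟩
  have hl1 := abs_log_sub_log_le hH₀.1 hs1.1 hs1.2
  have hl2 := abs_log_sub_log_le hH₀' hs2.1 hs2.2
  have hm1 := mul_sub_mul_le ha hl1 hτ1
  have hm2 := mul_sub_mul_le hb hl2 hτ1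
  have hg₀ : 0 ≤ ∑ m, θ₀.1.1 m * g m :=
    Finset.sum_nonneg fun m _ => mul_nonneg (hω₀ m).le (hg m)
  rw [betaStar_eq_exp θ₀.2.2.1 θ₀.2.2.2 hH₀, betaStar_eq_exp θ.2.2.1 θ.2.2.2 hH, ← mul_assoc,
    ← Real.exp_add]
  refine le_trans ?_ (mul_le_mul_of_nonneg_left hs3 (Real.exp_pos _).le)
  rw [← mul_assoc, ← Real.exp_add]
  refine mul_le_mul_of_nonneg_right (Real.exp_le_exp.2 ?_) hg₀
  have hC' := (abs_le.1 hC).1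
  have hL1 := mul_le_mul_of_nonneg_right hτδ (abs_nonneg (Real.log H₀))
  have hL2 := mul_le_mul_of_nonneg_right hτδ (abs_nonneg (Real.log (1 - H₀)))
  nlinarith

end KernelPerturbation

section Pool

variable {M : ℕ} {f : Fin M → ℝ → ℝ}

lemma pool_nonneg (hf0 : ∀ m y, 0 ≤ f m y) {ω : Fin M → ℝ} (hω : ω ∈ stdSimplex ℝ (Fin M))
    (y : ℝ) : 0 ≤ ∑ m, ω m * f m y :=
  Finset.sum_nonneg fun m _ => mul_nonneg (hω.1 m) (hf0 m y)

lemma cdfOf_pool (hf1 : ∀ m, ∫ y, f m y = 1) (ω : Fin M → ℝ) (y : ℝ) :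
    cdfOf (fun y => ∑ m, ω m * f m y) y = ∑ m, ω m * cdfOf (f m) y := by
  simp only [cdfOf]
  rw [integral_finsetSum _ fun m _ =>
    ((integrable_of_integral_eq_one (hf1 m)).integrableOn.const_mul _)]
  simp_rw [integral_const_mul]

lemma integral_pool (hf1 : ∀ m, ∫ y, f m y = 1) {ω : Fin M → ℝ}
    (hω : ω ∈ stdSimplex ℝ (Fin M)) : ∫ y, ∑ m, ω m * f m y = 1 := by
  rw [integral_finsetSum _ fun m _ => ((integrable_of_integral_eq_one (hf1 m)).const_mul _)]
  simp_rw [integral_const_mul, hf1, mul_one, hω.2]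

lemma measurable_pool (hfm : ∀ m, Measurable (f m)) (ω : Fin M → ℝ) :
    Measurable fun y => ∑ m, ω m * f m y :=
  Finset.measurable_sum _ fun m _ => (hfm m).const_mul _

lemma poolKernel_nonneg (hf0 : ∀ m y, 0 ≤ f m y) (hf1 : ∀ m, ∫ y, f m y = 1) (y : ℝ)
    (θ : ThetaSet M) : 0 ≤ poolKernel M f y θ := by
  refine mul_nonneg (betaStar_nonneg θ.2.2.1 θ.2.2.2 ?_) (pool_nonneg hf0 θ.2.1 y)
  rw [← cdfOf_pool hf1]
  exact cdfOf_mem_Icc (pool_nonneg hf0 θ.2.1) (integral_pool hf1 θ.2.1) y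

lemma measurable_poolKernel (hf1 : ∀ m, ∫ y, f m y = 1) (hfm : ∀ m, Measurable (f m)) :
    Measurable fun p : ℝ × ThetaSet M => poolKernel M f p.1 p.2 := by
  have hF : ∀ m, Measurable (cdfOf (f m)) := fun m => (continuous_cdfOf (hf1 m)).measurable
  have hc : Measurable fun p : ℝ × ThetaSet M => Real.Gamma p.2.1.2.2 /
      (Real.Gamma (p.2.1.2.1 * p.2.1.2.2) * Real.Gamma ((1 - p.2.1.2.1) * p.2.1.2.2)) :=
    (continuous_betaConst M).measurable.comp measurable_snd
  have hH : Measurable fun p : ℝ × ThetaSet M => ∑ m, p.2.1.1 m * cdfOf (f m) p.1 :=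
    Finset.measurable_sum _ fun m _ => by have := hF m; fun_prop
  have hh : Measurable fun p : ℝ × ThetaSet M => ∑ m, p.2.1.1 m * f m p.1 :=
    Finset.measurable_sum _ fun m _ => by have := hfm m; fun_prop
  unfold poolKernel betaStar
  exact ((hc.mul (hH.pow (by fun_prop))).mul ((hH.const_sub 1).pow (by fun_prop))).mul hh

lemma lintegral_poolKernel (hf0 : ∀ m y, 0 ≤ f m y) (hf1 : ∀ m, ∫ y, f m y = 1)
    (hfm : ∀ m, Measurable (f m)) (θ : ThetaSet M) :
    ∫⁻ y, ENNReal.ofReal (poolKernel M f y θ) = 1 := by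
  have h0 := pool_nonneg hf0 θ.2.1
  rw [← lintegral_betaStar θ.2.2.1 θ.2.2.2, ← lintegral_comp_cdfOf_mul h0 (measurable_pool hfm _)
    (integral_pool hf1 θ.2.1) (measurable_betaStar _ _).ennreal_ofReal]
  refine lintegral_congr fun y => ?_
  rw [← ENNReal.ofReal_mul' (h0 y), cdfOf_pool hf1, poolKernel]

lemma integrable_poolKernel_prod (hf0 : ∀ m y, 0 ≤ f m y) (hf1 : ∀ m, ∫ y, f m y = 1)
    (hfm : ∀ m, Measurable (f m)) (G : ProbabilityMeasure (ThetaSet M)) :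
    Integrable (fun p : ℝ × ThetaSet M => poolKernel M f p.1 p.2)
      ((volume : Measure ℝ).prod (G : Measure (ThetaSet M))) := by
  have hm := measurable_poolKernel hf1 hfm
  refine ⟨hm.aestronglyMeasurable, ?_⟩
  rw [hasFiniteIntegral_iff_ofReal (Eventually.of_forall fun p => poolKernel_nonneg hf0 hf1 _ _),
    lintegral_prod_symm _ hm.ennreal_ofReal.aemeasurable]
  simp [lintegral_poolKernel hf0 hf1 hfm]

end Pool

lemma sub_le_mul_log_div {a b : ℝ} (ha : 0 < a) (hb : 0 < b) : a - b ≤ a * Real.log (a / b) := by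
  have h := Real.one_sub_inv_le_log_of_pos (div_pos ha hb)
  calc a - b = a * (1 - (a / b)⁻¹) := by field_simp
    _ ≤ _ := mul_le_mul_of_nonneg_left h ha.le

/-- A finitely supported probability measure with prescribed weights and atoms. -/
lemma exists_probabilityMeasure_sum_dirac {X : Type*} [MeasurableSpace X]
    [MeasurableSingletonClass X] {ι : Type*} [Fintype ι] {c : ι → ℝ} (hc : ∀ k, 0 ≤ c k)
    (hsum : ∑ k, c k = 1) (θ : ι → X) :
    ∃ G : ProbabilityMeasure X, ∃ S : Finset X, (G : Measure X) ↑S = 1 ∧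
      (∀ x ∈ S, ∃ k, θ k = x) ∧ ∀ m : X → ℝ, ∫ x, m x ∂(G : Measure X) = ∑ k, c k * m (θ k) := by
  classical
  let P : Measure X := ∑ k, ENNReal.ofReal (c k) • Measure.dirac (θ k)
  have hsum' : ∑ k, ENNReal.ofReal (c k) = 1 := by
    rw [← ENNReal.ofReal_sum_of_nonneg fun k _ => hc k, hsum, ENNReal.ofReal_one]
  have hP : IsProbabilityMeasure P := ⟨by simp [P, hsum']⟩
  refine ⟨⟨P, hP⟩, Finset.univ.image θ, ?_, fun x hx => ?_, fun m => ?_⟩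
  · change P _ = 1
    simp [P, hsum']
  · simpa using hx
  · change ∫ x, m x ∂P = _
    rw [integral_finsetSum_measure fun k _ =>
      (integrable_dirac (by simp)).smul_measure ENNReal.ofReal_ne_top]
    simp [integral_smul_measure, hc]

/-- Theorem S (teocons3): Kullback–Leibler property when the true density is a
calibrated pool `f₀ = u₀(H(·|ω*)) h(·|ω*)`. -/
theorem beta_mixture_calibration_KL_property_calibrated_truth
    (M : ℕ) (Y : Set ℝ) (f : Fin M → ℝ → ℝ)
    -- f₁,…,f_M are continuous probability densities on Y
    (hf_nonneg : ∀ m y, 0 ≤ f m y)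
    (hf_supp : ∀ m, ∀ y ∉ Y, f m y = 0)
    (hf_meas : ∀ m, Measurable (f m))
    (hf_int : ∀ m, ∫ y, f m y = 1)
    (hf_cont : ∀ m, ContinuousOn (f m) Y)
    -- u₀ : a continuous probability density on (0,1)
    (u₀ : ℝ → ℝ)
    (hu₀_nonneg : ∀ x, 0 ≤ u₀ x)
    (hu₀_supp : ∀ x ∉ Ioo (0:ℝ) 1, u₀ x = 0)
    (hu₀_meas : Measurable u₀)
    (hu₀_cont : ContinuousOn u₀ (Ioo (0:ℝ) 1))
    (hu₀_int : ∫ x in Ioo (0:ℝ) 1, u₀ x = 1)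
    -- ∫₀¹ [|log x| + |log(1−x)|] u₀(x) dx < ∞
    (hu₀_log : IntegrableOn (fun x => (|Real.log x| + |Real.log (1 - x)|) * u₀ x)
      (Ioo (0:ℝ) 1))
    -- ∫₀¹ u₀ log u₀ < ∞
    (hu₀_ent : IntegrableOn (fun x => u₀ x * Real.log (u₀ x)) (Ioo (0:ℝ) 1))
    -- ω* in the interior of Δ_M
    (ωs : Fin M → ℝ)
    (hωs : ωs ∈ stdSimplex ℝ (Fin M)) (hωs_pos : ∀ m, 0 < ωs m)
    -- h(·|ω*) bounded below away from 0 on compacts of Y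
    (hinf : ∀ C : Set ℝ, C ⊆ Y → IsCompact C →
      ∃ c > 0, ∀ y ∈ C, c ≤ ∑ m, ωs m * f m y)
    -- the true density f₀(y) = u₀(H(y|ω*)) h(y|ω*)
    (f₀ : ℝ → ℝ)
    (hf₀ : ∀ y, f₀ y = u₀ (∑ m, ωs m * cdfOf (f m) y) * ∑ m, ωs m * f m y)
    -- the prior Π on M(Θ) whose weak support contains all finitely supported
    -- probability measures on Θ
    (Pr : Measure (ProbabilityMeasure (ThetaSet M)))
    (hPr : IsProbabilityMeasure Pr)
    (hsupp : ∀ G : ProbabilityMeasure (ThetaSet M),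
      (∃ s : Finset (ThetaSet M), (G : Measure (ThetaSet M)) ↑s = 1) →
      G ∈ measureSupport Pr) :
    ∀ ε > 0, 0 < Pr {G : ProbabilityMeasure (ThetaSet M) |
      Integrable (fun y => f₀ y * Real.log (f₀ y / mixDensity M f G y)) ∧
      ∫ y, f₀ y * Real.log (f₀ y / mixDensity M f G y) ≤ ε} := by
  intro ε hε
  have hu₀i : IntegrableOn u₀ (Ioo (0:ℝ) 1) := integrable_of_integral_eq_one hu₀_int
  obtain ⟨n, c, μ, ν, l, hc, hcsum, hμ, hν, hl, hli, hlint⟩ := exists_beta_mixture hu₀_nonneg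
    hu₀_meas hu₀_cont hu₀_supp hu₀_int hu₀_ent (half_pos hε)
  let Λ : ℝ → ℝ := fun x => |Real.log x| + |Real.log (1 - x)|
  set A := ∫ x in Ioo (0:ℝ) 1, Λ x * u₀ x with hA
  have hA0 : 0 ≤ A := integral_nonneg fun x => mul_nonneg (by positivity) (hu₀_nonneg x)
  set δ := ε / (2 * (2 + A)) with hδdef
  have hδ : 0 < δ := by positivity
  have hδA : δ * (2 + A) = ε / 2 := by rw [hδdef]; field_simp
  -- the dominating function on the unit interval
  let ψ : ℝ → ℝ := fun x => u₀ x * Real.log (u₀ x / l x) + δ * (2 * u₀ x + Λ x * u₀ x)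
  have hψr : IntegrableOn (fun x => δ * (2 * u₀ x + Λ x * u₀ x)) (Ioo (0:ℝ) 1) :=
    ((hu₀i.const_mul 2).add hu₀_log).const_mul δ
  have hψi : IntegrableOn ψ (Ioo (0:ℝ) 1) := hli.add hψr
  have hψint : ∫ x in Ioo (0:ℝ) 1, ψ x ≤ ε := by
    rw [integral_add hli hψr, integral_const_mul, integral_add (hu₀i.const_mul 2) hu₀_log,
      integral_const_mul, hu₀_int, mul_one, ← hA, hδA]
    linarith
  -- the true pool
  let h : ℝ → ℝ := fun y => ∑ m, ωs m * f m y
  let H : ℝ → ℝ := fun y => ∑ m, ωs m * cdfOf (f m) y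
  have hh0 : ∀ y, 0 ≤ h y := pool_nonneg hf_nonneg hωs
  have hh1 : ∫ y, h y = 1 := integral_pool hf_int hωs
  have hhm : Measurable h := measurable_pool hf_meas ωs
  have hHh : cdfOf h = H := funext fun y => cdfOf_pool hf_int ωs y
  have hf₀' : f₀ = fun y => u₀ (H y) * h y := funext hf₀
  have hf₀i : Integrable f₀ := by
    rw [hf₀', ← hHh]; exact integrable_comp_cdfOf_mul hh0 hhm hh1 hu₀i
  have hψHi : Integrable fun y => ψ (H y) * h y := by
    rw [← hHh]; exact integrable_comp_cdfOf_mul hh0 hhm hh1 hψi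
  have hψHint : ∫ y, ψ (H y) * h y ≤ ε := by
    rw [← hHh, integral_comp_cdfOf_mul hh0 hhm hh1 hψi]; exact hψint
  -- the finitely supported approximating measure
  let θ : Fin (n + 1) → ThetaSet M := fun k => ⟨(ωs, μ k, ν k), hωs, hμ k, hν k⟩
  obtain ⟨G₀, S, hS, hSθ, hG₀⟩ := exists_probabilityMeasure_sum_dirac hc hcsum θ
  let R : ℝ → ℝ := fun y => Real.exp (-(δ * (1 + |Real.log (H y)| + |Real.log (1 - H y)|)))
  let N : ThetaSet M → Set (ThetaSet M) := fun θ₀ => {θ' | ∀ y, H y ∈ Ioo (0:ℝ) 1 →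
    R y * poolKernel M f y θ₀ ≤ poolKernel M f y θ'}
  have hN : ∀ x ∈ S, N x ∈ 𝓝 x := by
    intro x hx
    obtain ⟨k, rfl⟩ := hSθ x hx
    filter_upwards [eventually_exp_mul_kernel_le (θ k) hωs_pos hδ] with θ' hθ' y hy
    exact hθ' (fun m => cdfOf (f m) y) (fun m => f m y)
      (fun m => cdfOf_mem_Icc (hf_nonneg m) (hf_int m) y) (fun m => hf_nonneg m y) hy
  obtain ⟨U, hU, hUo, hG₀U⟩ := mem_nhds_iff.1 (eventually_exp_mul_integral_le G₀ hS hN hδ)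
  refine (hsupp G₀ ⟨S, hS⟩ U hUo hG₀U).trans_le (measure_mono fun G hG => ?_)
  have hGev := hU hG
  have hprod := integrable_poolKernel_prod hf_nonneg hf_int hf_meas G
  have hGi : Integrable (mixDensity M f G) := hprod.integral_prod_left
  have hG0 : ∀ y, 0 ≤ mixDensity M f G y :=
    fun y => integral_nonneg fun θ' => poolKernel_nonneg hf_nonneg hf_int y θ'
  have hlower : ∀ᵐ y, H y ∈ Ioo (0:ℝ) 1 →
      Real.exp (-(δ * (2 + Λ (H y)))) * (l (H y) * h y) ≤ mixDensity M f G y := by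
    filter_upwards [hprod.prod_right_ae] with y hy hHy
    have hle := hGev (poolKernel M f y) (fun θ' => R y * poolKernel M f y θ')
      (poolKernel_nonneg hf_nonneg hf_int y)
      (fun θ' => mul_nonneg (Real.exp_pos _).le (poolKernel_nonneg hf_nonneg hf_int y θ')) hy
      (fun x _ θ' hθ' => hθ' y hHy)
    refine le_trans ?_ hle
    have hRy : Real.exp (-δ) * R y = Real.exp (-(δ * (2 + Λ (H y)))) := by
      simp only [R, Λ]
      rw [← Real.exp_add]
      congr 1
      ring
    have e2 : ∑ k, c k * poolKernel M f y (θ k) =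
        (∑ k, c k * betaStar (μ k) (ν k) (H y)) * h y := by
      rw [Finset.sum_mul]
      exact Finset.sum_congr rfl fun k _ => (mul_assoc _ _ _).symm
    rw [integral_const_mul, ← mul_assoc (Real.exp (-δ)), hRy, hG₀, e2]
    gcongr
    · exact hh0 y
    · exact (hl _ hHy).2
  have hbounds : ∀ᵐ y, f₀ y - mixDensity M f G y ≤ f₀ y * Real.log (f₀ y / mixDensity M f G y) ∧
      f₀ y * Real.log (f₀ y / mixDensity M f G y) ≤ ψ (H y) * h y := by
    filter_upwards [hlower] with y hy
    rw [hf₀']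
    rcases (hh0 y).eq_or_lt with h0 | hpos
    · simp [← h0, hG0 y]
    rcases (hu₀_nonneg (H y)).eq_or_lt with hu | hu
    · simp [ψ, ← hu, hG0 y]
    have hHy : H y ∈ Ioo (0:ℝ) 1 := by
      by_contra hc'
      exact hu.ne' (hu₀_supp _ hc')
    have hlpos := (hl _ hHy).1
    have hr : 0 < Real.exp (-(δ * (2 + Λ (H y)))) * (l (H y) * h y) := by positivity
    have hGpos := hr.trans_le (hy hHy)
    have hf₀pos : 0 < u₀ (H y) * h y := mul_pos hu hpos
    refine ⟨sub_le_mul_log_div hf₀pos hGpos, ?_⟩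
    have hlog := Real.log_le_log hr (hy hHy)
    rw [Real.log_mul (Real.exp_ne_zero _) (by positivity), Real.log_exp,
      Real.log_mul hlpos.ne' hpos.ne'] at hlog
    have e : ψ (H y) * h y = u₀ (H y) * h y *
        (Real.log (u₀ (H y)) - Real.log (l (H y)) + δ * (2 + Λ (H y))) := by
      simp only [ψ]
      rw [Real.log_div hu.ne' hlpos.ne']
      ring
    rw [e, Real.log_div hf₀pos.ne' hGpos.ne', Real.log_mul hu.ne' hpos.ne']
    exact mul_le_mul_of_nonneg_left (by linarith) hf₀pos.le
  have hKi : Integrable fun y => f₀ y * Real.log (f₀ y / mixDensity M f G y) := by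
    refine (((hf₀i.sub hGi).abs).add hψHi.abs).mono' ?_ ?_
    · exact (hf₀i.aemeasurable.mul (Real.measurable_log.comp_aemeasurable
        (hf₀i.aemeasurable.div hGi.aemeasurable))).aestronglyMeasurable
    · filter_upwards [hbounds] with y hy
      simp only [Pi.add_apply, Pi.sub_apply, Real.norm_eq_abs]
      rw [abs_le]
      constructor
      · linarith [hy.1, neg_abs_le (f₀ y - mixDensity M f G y), abs_nonneg (ψ (H y) * h y)]
      · linarith [hy.2, le_abs_self (ψ (H y) * h y), abs_nonneg (f₀ y - mixDensity M f G y)]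
  exact ⟨hKi, (integral_mono_ae hKi hψHi (hbounds.mono fun y hy => hy.2)).trans hψHint⟩
end

section
/- Let M ≥ 1, let σ₁,…,σ_M and σ₋, σ₊ satisfy 0 < σ₋ < min_{m} σ_m ≤ max_{m} σ_m < σ₊, and let μ₁,…,μ_M ∈ ℝ. Set C⁻ = max_{m=1,…,M} (σ_m² − σ₋²)^{−1} and C⁺ = max_{m=1,…,M} (σ₊² − σ_m²)^{−1}. Then for every y ∈ ℝ and every m = 1,…,M: (σ₋/σ₊) e^{−C⁻ μ_m²/2} φ(y|0,σ₋²) ≤ φ(y|μ_m, σ_m²) ≤ (σ₊/σ₋) e^{C⁺ μ_m²/2} φ(y|0,σ₊²). -/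
open Set

/-- Density `φ(y|μ,σ²)` of the normal distribution with mean `μ` and variance `σ2`. -/
noncomputable def gaussDensity (μ σ2 y : ℝ) : ℝ :=
  (Real.sqrt (2 * Real.pi * σ2))⁻¹ * Real.exp (-((y - μ) ^ 2) / (2 * σ2))

/-- Sedrakyan's inequality for two terms. -/
theorem sq_sub_div_le {s t : ℝ} (hs : 0 < s) (hst : s < t) (x y : ℝ) :
    (x - y) ^ 2 / t ≤ x ^ 2 / s + y ^ 2 / (t - s) := by
  have hts : 0 < t - s := sub_pos.2 hst
  have ht : 0 < t := hs.trans hst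
  have h : x ^ 2 / s + y ^ 2 / (t - s) - (x - y) ^ 2 / t
      = ((t - s) * x + s * y) ^ 2 / (s * (t - s) * t) := by
    field_simp
    ring
  have : 0 ≤ ((t - s) * x + s * y) ^ 2 / (s * (t - s) * t) := by positivity
  linarith

theorem gaussDensity_sq {s : ℝ} (hs : 0 < s) (μ y : ℝ) :
    gaussDensity μ (s ^ 2) y =
      (Real.sqrt (2 * Real.pi))⁻¹ * s⁻¹ * Real.exp (-((y - μ) ^ 2) / (2 * s ^ 2)) := by
  rw [gaussDensity, Real.sqrt_mul (by positivity), Real.sqrt_sq hs.le, mul_inv]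

/-- A Gaussian density dominates a rescaled Gaussian density of smaller variance. -/
theorem mul_exp_mul_gaussDensity_le {r s t C : ℝ} (hs : 0 < s) (hst : s < t)
    (hr : r ≤ s / t) (hC : (t ^ 2 - s ^ 2)⁻¹ ≤ C) (μ ν y : ℝ) :
    r * Real.exp (-C * (μ - ν) ^ 2 / 2) * gaussDensity ν (s ^ 2) y ≤
      gaussDensity μ (t ^ 2) y := by
  have ht : 0 < t := hs.trans hst
  have hsq : s ^ 2 < t ^ 2 := by gcongr
  have hexp : -C * (μ - ν) ^ 2 / 2 + -((y - ν) ^ 2) / (2 * s ^ 2) ≤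
      -((y - μ) ^ 2) / (2 * t ^ 2) := by
    have h := sq_sub_div_le (by positivity) hsq (y - ν) (μ - ν)
    rw [sub_sub_sub_cancel_right, div_eq_mul_inv ((μ - ν) ^ 2)] at h
    have h' := mul_le_mul_of_nonneg_left hC (sq_nonneg (μ - ν))
    rw [neg_div, neg_div, mul_comm 2 (s ^ 2), mul_comm 2 (t ^ 2), ← div_div, ← div_div]
    linarith
  have hrs : r * s⁻¹ ≤ t⁻¹ := by
    calc r * s⁻¹ ≤ s / t * s⁻¹ := by gcongr
      _ = t⁻¹ := by field_simp
  rw [gaussDensity_sq hs, gaussDensity_sq ht]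
  calc r * Real.exp (-C * (μ - ν) ^ 2 / 2) *
        ((Real.sqrt (2 * Real.pi))⁻¹ * s⁻¹ * Real.exp (-((y - ν) ^ 2) / (2 * s ^ 2)))
      = (Real.sqrt (2 * Real.pi))⁻¹ * (r * s⁻¹) *
        Real.exp (-C * (μ - ν) ^ 2 / 2 + -((y - ν) ^ 2) / (2 * s ^ 2)) := by
        rw [Real.exp_add]
        ring
    _ ≤ (Real.sqrt (2 * Real.pi))⁻¹ * t⁻¹ * Real.exp (-((y - μ) ^ 2) / (2 * t ^ 2)) := by
        gcongr

/-- Lemma S: two-sided Gaussian comparison bounds for mixture components. -/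
theorem gaussian_component_bounds
    (M : ℕ) (hM : 0 < M) (σ : Fin M → ℝ) (σlo σhi : ℝ) (μ : Fin M → ℝ)
    (hσlo : 0 < σlo) (h1 : ∀ m, σlo < σ m) (h2 : ∀ m, σ m < σhi) :
    ∀ (y : ℝ) (m : Fin M),
      (σlo / σhi) *
          Real.exp (-(Finset.univ.sup' ⟨⟨0, hM⟩, Finset.mem_univ _⟩
              fun i => (σ i ^ 2 - σlo ^ 2)⁻¹) * μ m ^ 2 / 2) *
          gaussDensity 0 (σlo ^ 2) y ≤ gaussDensity (μ m) (σ m ^ 2) y ∧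
      gaussDensity (μ m) (σ m ^ 2) y ≤
        (σhi / σlo) *
          Real.exp ((Finset.univ.sup' ⟨⟨0, hM⟩, Finset.mem_univ _⟩
              fun i => (σhi ^ 2 - σ i ^ 2)⁻¹) * μ m ^ 2 / 2) *
          gaussDensity 0 (σhi ^ 2) y := by
  intro y m
  have hm : 0 < σ m := hσlo.trans (h1 m)
  have hhi : 0 < σhi := hm.trans (h2 m)
  constructor
  · have h := mul_exp_mul_gaussDensity_le hσlo (h1 m)
      (div_le_div_of_nonneg_left hσlo.le hm (h2 m).le)
      (Finset.le_sup' (fun i => (σ i ^ 2 - σlo ^ 2)⁻¹) (Finset.mem_univ m)) (μ m) 0 y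
    rwa [sub_zero] at h
  · have h := mul_exp_mul_gaussDensity_le hm (h2 m)
      (div_le_div_of_nonneg_right (h1 m).le hhi.le)
      (Finset.le_sup' (fun i => (σhi ^ 2 - σ i ^ 2)⁻¹) (Finset.mem_univ m)) 0 (μ m) y
    rw [zero_sub, neg_sq, neg_mul, neg_div, Real.exp_neg, ← inv_div σhi σlo, ← mul_inv,
      inv_mul_le_iff₀ (by positivity)] at h
    exact h
end

section
/- Let M ≥ 1, μ₁,…,μ_M, μ₀ ∈ ℝ and σ₁,…,σ_M, σ₀ > 0. Let f₀(y) = φ(y|μ₀,σ₀²), let ω* = (1/M,…,1/M), and set h(y|ω*) = (1/M) Σ_{m=1}^M φ(y|μ_m,σ_m²) and H(y|ω*) = (1/M) Σ_{m=1}^M Φ(y|μ_m,σ_m²). Then ∫_ℝ [|log(H(y|ω*))| + |log(1−H(y|ω*))|] f₀(y) dy < +∞ and KL(f₀, h(·|ω*)) < +∞. -/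
open MeasureTheory Set

/-- Cdf `Φ(y|μ,σ²)` of the normal distribution with mean `μ` and variance `σ2`. -/
noncomputable def gaussCdf (μ σ2 y : ℝ) : ℝ := ∫ z in Iic y, gaussDensity μ σ2 z

open ProbabilityTheory

lemma gaussDensity_eq_gaussianPDFReal (μ : ℝ) {v : ℝ} (hv : 0 ≤ v) :
    gaussDensity μ v = gaussianPDFReal μ v.toNNReal := by
  ext y
  simp [gaussDensity, gaussianPDFReal, Real.coe_toNNReal v hv]

lemma gaussDensity_nonneg (μ v y : ℝ) : 0 ≤ gaussDensity μ v y := by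
  unfold gaussDensity; positivity

lemma measurable_gaussDensity (μ v : ℝ) : Measurable (gaussDensity μ v) := by
  unfold gaussDensity; fun_prop

lemma integrable_gaussDensity (μ : ℝ) {v : ℝ} (hv : 0 < v) : Integrable (gaussDensity μ v) := by
  rw [gaussDensity_eq_gaussianPDFReal μ hv.le]
  exact integrable_gaussianPDFReal _ _

lemma integral_gaussDensity (μ : ℝ) {v : ℝ} (hv : 0 < v) : ∫ y, gaussDensity μ v y = 1 := by
  rw [gaussDensity_eq_gaussianPDFReal μ hv.le]
  exact integral_gaussianPDFReal_eq_one _ (Real.toNNReal_pos.2 hv).ne'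

lemma one_sub_gaussCdf (μ : ℝ) {v : ℝ} (hv : 0 < v) (y : ℝ) :
    1 - gaussCdf μ v y = ∫ z in Ioi y, gaussDensity μ v z := by
  have h := integral_add_compl (measurableSet_Iic (a := y)) (integrable_gaussDensity μ hv)
  rw [integral_gaussDensity μ hv, compl_Iic] at h
  rw [← h, gaussCdf]
  ring

lemma measurable_gaussCdf (μ : ℝ) {v : ℝ} (hv : 0 < v) : Measurable (gaussCdf μ v) := by
  refine Monotone.measurable fun a b hab => ?_
  exact setIntegral_mono_set (integrable_gaussDensity μ hv).integrableOn
    (Filter.Eventually.of_forall fun z => gaussDensity_nonneg μ v z)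
    (Iic_subset_Iic.2 hab).eventuallyLE

lemma integrable_one_add_sq_mul_gaussDensity (μ : ℝ) {v : ℝ} (hv : 0 < v) :
    Integrable fun y => (1 + y ^ 2) * gaussDensity μ v y := by
  have hv' : v.toNNReal ≠ 0 := (Real.toNNReal_pos.2 hv).ne'
  have h : Integrable (fun y : ℝ => 1 + y ^ 2) (gaussianReal μ v.toNNReal) :=
    (integrable_const 1).add (memLp_id_gaussianReal 2).integrable_sq
  rw [gaussianReal_of_var_ne_zero _ hv', integrable_withDensity_iff_integrable_smul'
    (measurable_gaussianPDF _ _) (Filter.Eventually.of_forall fun _ => gaussianPDF_lt_top)] at h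
  refine h.congr (Filter.Eventually.of_forall fun y => ?_)
  simp only [toReal_gaussianPDF, smul_eq_mul, gaussDensity_eq_gaussianPDFReal μ hv.le]
  ring

/-- A function trapped between `exp (-C (1 + y²))` and `exp (C (1 + y²))` for some `C ≥ 0`, so that
its logarithm grows at most quadratically. -/
def ExpQuadBounded (f : ℝ → ℝ) : Prop :=
  ∃ C, 0 ≤ C ∧ ∀ y, Real.exp (-(C * (1 + y ^ 2))) ≤ f y ∧ f y ≤ Real.exp (C * (1 + y ^ 2))

namespace ExpQuadBounded

lemma div {f g : ℝ → ℝ} (hf : ExpQuadBounded f) (hg : ExpQuadBounded g) :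
    ExpQuadBounded fun y => f y / g y := by
  obtain ⟨C, hC, hf⟩ := hf
  obtain ⟨D, hD, hg⟩ := hg
  refine ⟨C + D, by positivity, fun y => ?_⟩
  have hg0 := (Real.exp_pos _).trans_le (hg y).1
  constructor
  · rw [le_div_iff₀ hg0]
    calc _ ≤ Real.exp (-((C + D) * (1 + y ^ 2))) * Real.exp (D * (1 + y ^ 2)) := by
          gcongr; exact (hg y).2
      _ = Real.exp (-(C * (1 + y ^ 2))) := by rw [← Real.exp_add]; ring_nf
      _ ≤ f y := (hf y).1
  · rw [div_le_iff₀ hg0]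
    calc f y ≤ Real.exp (C * (1 + y ^ 2)) := (hf y).2
      _ = Real.exp ((C + D) * (1 + y ^ 2)) * Real.exp (-(D * (1 + y ^ 2))) := by
          rw [← Real.exp_add]; ring_nf
      _ ≤ _ := by gcongr; exact (hg y).1

lemma average {M : ℕ} (hM : 0 < M) {f : Fin M → ℝ → ℝ} (hf : ∀ m, ExpQuadBounded (f m)) :
    ExpQuadBounded fun y => (M : ℝ)⁻¹ * ∑ m, f m y := by
  choose C hC hf using hf
  have hM' : (0 : ℝ) < M := by exact_mod_cast hM
  have hle (m : Fin M) : C m ≤ ∑ i, C i :=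
    Finset.single_le_sum (fun i _ => hC i) (Finset.mem_univ m)
  refine ⟨∑ m, C m, Finset.sum_nonneg fun m _ => hC m, fun y => ⟨?_, ?_⟩⟩
  · dsimp only
    rw [inv_mul_eq_div, le_div_iff₀ hM']
    have h := Finset.card_nsmul_le_sum Finset.univ (fun m => f m y)
      (Real.exp (-((∑ m, C m) * (1 + y ^ 2)))) fun m _ => le_trans (by gcongr; exact hle m) (hf m y).1
    simpa [mul_comm] using h
  · dsimp only
    rw [inv_mul_eq_div, div_le_iff₀ hM']
    have h := Finset.sum_le_card_nsmul Finset.univ (fun m => f m y)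
      (Real.exp ((∑ m, C m) * (1 + y ^ 2))) fun m _ => (hf m y).2.trans (by gcongr; exact hle m)
    simpa [mul_comm] using h

lemma integrable_log_mul_gaussDensity {f : ℝ → ℝ} (hf : ExpQuadBounded f) (hfm : Measurable f)
    (μ : ℝ) {v : ℝ} (hv : 0 < v) :
    Integrable fun y => Real.log (f y) * gaussDensity μ v y := by
  obtain ⟨C, -, hf⟩ := hf
  refine ((integrable_one_add_sq_mul_gaussDensity μ hv).const_mul C).mono'
    (hfm.log.mul (measurable_gaussDensity μ v)).aestronglyMeasurable
    (Filter.Eventually.of_forall fun y => ?_)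
  have h0 := (Real.exp_pos _).trans_le (hf y).1
  rw [norm_mul, Real.norm_eq_abs, Real.norm_of_nonneg (gaussDensity_nonneg μ v y), ← mul_assoc]
  refine mul_le_mul_of_nonneg_right (abs_le.2 ⟨?_, ?_⟩) (gaussDensity_nonneg μ v y)
  · exact (Real.le_log_iff_exp_le h0).2 (hf y).1
  · exact (Real.log_le_iff_le_exp h0).2 (hf y).2

end ExpQuadBounded

lemma exists_exp_le_gaussDensity (μ : ℝ) {v : ℝ} (hv : 0 < v) :
    ∃ C, 0 ≤ C ∧ ∀ y z, |z - y| ≤ 1 → Real.exp (-(C * (1 + y ^ 2))) ≤ gaussDensity μ v z := by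
  set s := (Real.sqrt (2 * Real.pi * v))⁻¹
  have hs0 : 0 < s := by positivity
  refine ⟨|Real.log s| + 3 * (1 + μ ^ 2) / (2 * v), by positivity, fun y z hz => ?_⟩
  have hlog : Real.exp (-(|Real.log s| * (1 + y ^ 2))) ≤ s := by
    rw [← Real.le_log_iff_exp_le hs0]
    nlinarith [neg_abs_le (Real.log s), mul_nonneg (abs_nonneg (Real.log s)) (sq_nonneg y)]
  have hsq : (z - μ) ^ 2 ≤ 3 * (1 + μ ^ 2) * (1 + y ^ 2) := by
    have h1 : (z - y) ^ 2 ≤ 1 := (sq_le_one_iff_abs_le_one _).2 hz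
    nlinarith [sq_nonneg ((z - y) - y), sq_nonneg ((z - y) + μ), sq_nonneg (y + μ),
      mul_nonneg (sq_nonneg μ) (sq_nonneg y)]
  calc _ = Real.exp (-(|Real.log s| * (1 + y ^ 2))) *
        Real.exp (-(3 * (1 + μ ^ 2) * (1 + y ^ 2)) / (2 * v)) := by
        rw [← Real.exp_add]; congr 1; ring
    _ ≤ gaussDensity μ v z := by
        rw [gaussDensity]; gcongr

lemma expQuadBounded_gaussDensity (μ : ℝ) {v : ℝ} (hv : 0 < v) :
    ExpQuadBounded (gaussDensity μ v) := by
  obtain ⟨C, hC, h⟩ := exists_exp_le_gaussDensity μ hv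
  set s := (Real.sqrt (2 * Real.pi * v))⁻¹
  have hs0 : 0 < s := by positivity
  refine ⟨C + |Real.log s|, by positivity, fun y => ⟨?_, ?_⟩⟩
  · refine le_trans ?_ (h y y (by simp))
    gcongr
    exact le_add_of_nonneg_right (abs_nonneg _)
  · calc gaussDensity μ v y ≤ s * 1 := by
          rw [gaussDensity]
          gcongr
          refine Real.exp_le_one_iff.2 (div_nonpos_of_nonpos_of_nonneg ?_ (by positivity))
          exact neg_nonpos.2 (sq_nonneg _)
      _ = Real.exp (Real.log s) := by rw [Real.exp_log hs0, mul_one]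
      _ ≤ _ := by
          gcongr
          nlinarith [le_abs_self (Real.log s), mul_nonneg (abs_nonneg (Real.log s)) (sq_nonneg y),
            mul_nonneg hC (sq_nonneg y)]

/-- The Gaussian mass of a set that contains an interval of length one near `y`. -/
lemma expQuadBounded_setIntegral_gaussDensity (μ : ℝ) {v : ℝ} (hv : 0 < v) {S : ℝ → Set ℝ}
    {a : ℝ → ℝ} (hS : ∀ y, Ioc (a y) (a y + 1) ⊆ S y)
    (ha : ∀ y, ∀ z ∈ Ioc (a y) (a y + 1), |z - y| ≤ 1) :
    ExpQuadBounded fun y => ∫ z in S y, gaussDensity μ v z := by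
  obtain ⟨C, hC, h⟩ := exists_exp_le_gaussDensity μ hv
  have hi := integrable_gaussDensity μ hv
  have h0 : 0 ≤ᵐ[volume] gaussDensity μ v :=
    Filter.Eventually.of_forall (gaussDensity_nonneg μ v)
  refine ⟨C, hC, fun y => ⟨?_, ?_⟩⟩
  · calc Real.exp (-(C * (1 + y ^ 2)))
        = ∫ _ in Ioc (a y) (a y + 1), Real.exp (-(C * (1 + y ^ 2))) := by simp
      _ ≤ ∫ z in Ioc (a y) (a y + 1), gaussDensity μ v z :=
          setIntegral_mono_on (integrableOn_const (by simp)) hi.integrableOn measurableSet_Ioc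
            fun z hz => h y z (ha y z hz)
      _ ≤ _ := setIntegral_mono_set hi.integrableOn (ae_restrict_of_ae h0) (hS y).eventuallyLE
  · calc _ ≤ ∫ z, gaussDensity μ v z := setIntegral_le_integral hi h0
      _ = 1 := integral_gaussDensity μ hv
      _ ≤ _ := Real.one_le_exp (by positivity)

lemma expQuadBounded_gaussCdf (μ : ℝ) {v : ℝ} (hv : 0 < v) : ExpQuadBounded (gaussCdf μ v) :=
  expQuadBounded_setIntegral_gaussDensity μ hv (S := Iic) (a := fun y => y - 1)
    (fun y z hz => by simpa using hz.2)
    fun y z hz => abs_le.2 ⟨by linarith [hz.1], by linarith [hz.2]⟩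

lemma expQuadBounded_one_sub_gaussCdf (μ : ℝ) {v : ℝ} (hv : 0 < v) :
    ExpQuadBounded fun y => 1 - gaussCdf μ v y := by
  simp only [one_sub_gaussCdf μ hv]
  exact expQuadBounded_setIntegral_gaussDensity μ hv (a := fun y => y)
    (fun y z hz => hz.1) fun y z hz => abs_le.2 ⟨by linarith [hz.1], by linarith [hz.2]⟩

/-- Example 1 (complete and incomplete model set): the entropy conditions of Theorem 1
hold for a Gaussian true density and the equally weighted Gaussian pool. -/
theorem gaussian_pool_entropy_conditions
    (M : ℕ) (hM : 0 < M) (μ : Fin M → ℝ) (σ : Fin M → ℝ) (hσ : ∀ m, 0 < σ m)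
    (μ₀ σ₀ : ℝ) (hσ₀ : 0 < σ₀) :
    Integrable (fun y =>
      (|Real.log ((M : ℝ)⁻¹ * ∑ m, gaussCdf (μ m) (σ m ^ 2) y)| +
        |Real.log (1 - (M : ℝ)⁻¹ * ∑ m, gaussCdf (μ m) (σ m ^ 2) y)|) *
        gaussDensity μ₀ (σ₀ ^ 2) y) ∧
    Integrable (fun y => gaussDensity μ₀ (σ₀ ^ 2) y *
      Real.log (gaussDensity μ₀ (σ₀ ^ 2) y /
        ((M : ℝ)⁻¹ * ∑ m, gaussDensity (μ m) (σ m ^ 2) y))) := by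
  have hv (m : Fin M) : 0 < σ m ^ 2 := pow_pos (hσ m) 2
  have hv₀ : 0 < σ₀ ^ 2 := pow_pos hσ₀ 2
  have hH : Measurable fun y => (M : ℝ)⁻¹ * ∑ m, gaussCdf (μ m) (σ m ^ 2) y :=
    (Finset.measurable_fun_sum _ fun m _ => measurable_gaussCdf (μ m) (hv m)).const_mul _
  have hh : Measurable fun y => (M : ℝ)⁻¹ * ∑ m, gaussDensity (μ m) (σ m ^ 2) y :=
    (Finset.measurable_fun_sum _ fun m _ => measurable_gaussDensity (μ m) _).const_mul _
  have hcompl (y : ℝ) : 1 - (M : ℝ)⁻¹ * ∑ m, gaussCdf (μ m) (σ m ^ 2) y =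
      (M : ℝ)⁻¹ * ∑ m, (1 - gaussCdf (μ m) (σ m ^ 2) y) := by
    have hM' : (M : ℝ) ≠ 0 := by exact_mod_cast hM.ne'
    simp [mul_sub, hM']
  have hb := ExpQuadBounded.average hM fun m => expQuadBounded_one_sub_gaussCdf (μ m) (hv m)
  simp only [← hcompl] at hb
  constructor
  · have h1 := (ExpQuadBounded.average hM fun m =>
      expQuadBounded_gaussCdf (μ m) (hv m)).integrable_log_mul_gaussDensity hH μ₀ hv₀
    have h2 := hb.integrable_log_mul_gaussDensity (measurable_const.sub hH) μ₀ hv₀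
    refine (h1.abs.add h2.abs).congr (Filter.Eventually.of_forall fun y => ?_)
    simp only [Pi.add_apply, abs_mul, abs_of_nonneg (gaussDensity_nonneg μ₀ (σ₀ ^ 2) y), add_mul]
  · simp only [mul_comm (gaussDensity μ₀ (σ₀ ^ 2) _)]
    exact ((expQuadBounded_gaussDensity μ₀ hv₀).div (ExpQuadBounded.average hM fun m =>
      expQuadBounded_gaussDensity (μ m) (hv m))).integrable_log_mul_gaussDensity
        ((measurable_gaussDensity _ _).div hh) μ₀ hv₀
end
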